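/- Let C₁ and C₂ be curves in P³ of degrees d₁, d₂ and arithmetic genera g₁, g₂, geometrically linked by a complete intersection X of two surfaces of degrees a and b (so d₁ + d₂ = ab). Then g₁ − g₂ = ½ (a + b − 4)(d₁ − d₂). -/

import Mathlib

attribute [local instance] MvPolynomial.gradedAlgebra

/-- Height of an ideal. -/
noncomputable def idealHeight {R : Type*} [CommRing R] (I : Ideal R) : WithBot ℕ∞ :=
  ⨅ p : {p : PrimeSpectrum R // I ≤ p.asIdeal},
    Order.krullDim {q : PrimeSpectrum R // q ≤ p.1}

/-- The Hilbert function of `R/A`, `j ↦ dim_K [R/A]_j`. -/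
noncomputable def hilbFn {K : Type*} [Field K] {σ : Type*}
    (A : Ideal (MvPolynomial σ K)) (j : ℕ) : ℕ :=
  Module.finrank K
    (↥(MvPolynomial.homogeneousSubmodule σ K j) ⧸
      Submodule.comap (MvPolynomial.homogeneousSubmodule σ K j).subtype
        (Submodule.restrictScalars K (A : Submodule (MvPolynomial σ K) (MvPolynomial σ K))))

open MvPolynomial in
/-- Homogeneous components of a product with a homogeneous element. -/
theorem lk_comp_mul {K : Type*} [Field K] {h : MvPolynomial (Fin 4) K} {e : ℕ}
    (hh : h.IsHomogeneous e) (n : ℕ) (c : MvPolynomial (Fin 4) K) :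
    homogeneousComponent (e + n) (h * c) = h * homogeneousComponent n c := by
  induction c using MvPolynomial.induction_on' with
  | monomial d r =>
    have h1 : (monomial d r : MvPolynomial (Fin 4) K).IsHomogeneous d.degree :=
      isHomogeneous_monomial r rfl
    rw [homogeneousComponent_of_mem h1, homogeneousComponent_of_mem (hh.mul h1)]
    by_cases hn : n = d.degree <;> simp [hn]
  | add p q hp hq => simp [mul_add, hp, hq]

open MvPolynomial in
theorem lk_comp_mul_low {K : Type*} [Field K] {h : MvPolynomial (Fin 4) K} {e : ℕ}
    (hh : h.IsHomogeneous e) {n : ℕ} (hn : n < e) (c : MvPolynomial (Fin 4) K) :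
    homogeneousComponent n (h * c) = 0 := by
  induction c using MvPolynomial.induction_on' with
  | monomial d r =>
    have h1 : (monomial d r : MvPolynomial (Fin 4) K).IsHomogeneous d.degree :=
      isHomogeneous_monomial r rfl
    rw [homogeneousComponent_of_mem (hh.mul h1), if_neg (by omega)]
  | add p q hp hq => simp [mul_add, hp, hq]

/-- The ideal `B + (h)`. -/
def lkJ {A : Type*} [CommRing A] (B : Ideal A) (h : A) : Ideal A := B ⊔ Ideal.span {h}

theorem lk_mem_J {A : Type*} [CommRing A] {B : Ideal A} {h x : A} :
    x ∈ lkJ B h ↔ ∃ b ∈ B, ∃ c, x = b + h * c := by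
  unfold lkJ
  rw [Submodule.mem_sup]
  constructor
  · rintro ⟨b, hb, y, hy, rfl⟩
    obtain ⟨c, rfl⟩ := Ideal.mem_span_singleton'.1 hy
    exact ⟨b, hb, c, by ring⟩
  · rintro ⟨b, hb, c, rfl⟩
    exact ⟨b, hb, h * c, Ideal.mul_mem_right _ _ (Ideal.mem_span_singleton_self h), rfl⟩

theorem lk_J_comm {A : Type*} [CommRing A] (B : Ideal A) (h k : A) :
    lkJ (lkJ B h) k = lkJ (lkJ B k) h := sup_right_comm _ _ _

theorem lk_le_J {A : Type*} [CommRing A] (B : Ideal A) (h : A) : B ≤ lkJ B h := le_sup_left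

theorem lk_self_mem_J {A : Type*} [CommRing A] (B : Ideal A) (h : A) : h ∈ lkJ B h :=
  lk_mem_J.2 ⟨0, B.zero_mem, 1, by ring⟩

/-- `h` is a nonzerodivisor modulo `B`. -/
def lkNZ {A : Type*} [CommRing A] (B : Ideal A) (h : A) : Prop := ∀ x, h * x ∈ B → x ∈ B

theorem lkNZ.pow {A : Type*} [CommRing A] {B : Ideal A} {h : A} (H : lkNZ B h) (n : ℕ) :
    lkNZ B (h ^ n) := by
  induction n with
  | zero => intro x hx; simpa using hx
  | succ n ih => intro x hx; exact H x (ih _ (by rwa [← mul_assoc, ← pow_succ]))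

/-- Homogeneous ideals of the polynomial ring. -/
abbrev lkHom {K : Type*} [Field K] (B : Ideal (MvPolynomial (Fin 4) K)) : Prop :=
  B.IsHomogeneous (MvPolynomial.homogeneousSubmodule (Fin 4) K)

theorem lkHom.J {K : Type*} [Field K] {B : Ideal (MvPolynomial (Fin 4) K)} (hB : lkHom B)
    {h : MvPolynomial (Fin 4) K} {e : ℕ} (hh : h.IsHomogeneous e) : lkHom (lkJ B h) := by
  apply Ideal.IsHomogeneous.sup hB
  apply Ideal.homogeneous_span
  intro x hx
  rw [Set.mem_singleton_iff] at hx
  subst hx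
  exact ⟨e, hh⟩

theorem lkHom.bot {K : Type*} [Field K] : lkHom (⊥ : Ideal (MvPolynomial (Fin 4) K)) :=
  Ideal.IsHomogeneous.bot _

theorem lk_low {K : Type*} [Field K] {B : Ideal (MvPolynomial (Fin 4) K)} (hB : lkHom B)
    {h x : MvPolynomial (Fin 4) K} {e n : ℕ} (hh : h.IsHomogeneous e)
    (hx : x.IsHomogeneous n) (hn : n < e) (hxJ : x ∈ lkJ B h) : x ∈ B := by
  obtain ⟨b, hb, c, rfl⟩ := lk_mem_J.1 hxJ
  rw [← MvPolynomial.homogeneousComponent_eq_self hx, map_add, lk_comp_mul_low hh hn, add_zero]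
  exact MvPolynomial.homogeneousComponent_mem_of_mem hB hb n

theorem lk_swap {A : Type*} [CommRing A] {B : Ideal A} {a b : A}
    (ha : lkNZ B a) (hb : lkNZ (lkJ B a) b) : lkNZ (lkJ B b) a := by
  intro x hx
  obtain ⟨β, hβ, y, hy⟩ := lk_mem_J.1 hx
  have h1 : b * y ∈ lkJ B a := lk_mem_J.2 ⟨-β, B.neg_mem hβ, x, by linear_combination -hy⟩
  obtain ⟨β', hβ', z, hz⟩ := lk_mem_J.1 (hb y h1)
  have h2 : a * (x - b * z) ∈ B := by
    have : a * (x - b * z) = β + b * β' := by rw [hz] at hy; linear_combination hy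
    rw [this]
    exact B.add_mem hβ (B.mul_mem_left _ hβ')
  exact lk_mem_J.2 ⟨_, ha _ h2, z, by ring⟩

theorem lk_perm {K : Type*} [Field K] {B : Ideal (MvPolynomial (Fin 4) K)} (hB : lkHom B)
    {a b : MvPolynomial (Fin 4) K} {e : ℕ} (hae : a.IsHomogeneous e) (he : 0 < e)
    (ha : lkNZ B a) (hb : lkNZ (lkJ B a) b) : lkNZ B b := by
  have key : ∀ n x, b * x ∈ B → x ∈ lkJ B (a ^ n) := by
    intro n
    induction n with
    | zero => intro x _; exact lk_mem_J.2 ⟨0, B.zero_mem, x, by ring⟩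
    | succ n ih =>
      intro x hx
      obtain ⟨β, hβ, y, rfl⟩ := lk_mem_J.1 (hb x (lk_le_J B a hx))
      have h1 : a * (b * y) ∈ B := by
        have : a * (b * y) = b * (β + a * y) - b * β := by ring
        rw [this]
        exact B.sub_mem hx (B.mul_mem_left _ hβ)
      obtain ⟨β', hβ', z, rfl⟩ := lk_mem_J.1 (ih y (ha _ h1))
      exact lk_mem_J.2 ⟨β + a * β', B.add_mem hβ (B.mul_mem_left _ hβ'), z, by ring⟩
  intro x hx
  rw [MvPolynomial.mem_iff_homogeneousComponent_mem hB]
  intro n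
  have h1 := hae.pow (n + 1)
  refine lk_low hB h1 (MvPolynomial.homogeneousComponent_isHomogeneous n x) ?_
    (MvPolynomial.homogeneousComponent_mem_of_mem (hB.J h1) (key (n + 1) x hx) n)
  nlinarith

/-- The irrelevant maximal ideal is not associated to `B`. -/
def lkSoc {K : Type*} [Field K] (B : Ideal (MvPolynomial (Fin 4) K)) : Prop :=
  ∀ x, (∀ i, MvPolynomial.X i * x ∈ B) → x ∈ B

/-- The irrelevant maximal ideal. -/
noncomputable def lkM (K : Type*) [Field K] : Ideal (MvPolynomial (Fin 4) K) :=
  Ideal.span (Set.range MvPolynomial.X)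

theorem lk_mul_mem_of_mem_M {K : Type*} [Field K] {B : Ideal (MvPolynomial (Fin 4) K)}
    {h x : MvPolynomial (Fin 4) K} (hh : h ∈ lkM K)
    (hx : ∀ i, MvPolynomial.X i * x ∈ B) : h * x ∈ B := by
  have : lkM K ≤ Submodule.colon B {x} := by
    unfold lkM
    rw [Ideal.span_le]
    rintro _ ⟨i, rfl⟩
    simpa [Submodule.mem_colon_singleton] using hx i
  simpa [Submodule.mem_colon_singleton] using this hh

theorem lk_mem_M {K : Type*} [Field K] {h : MvPolynomial (Fin 4) K} :
    h ∈ lkM K ↔ MvPolynomial.coeff 0 h = 0 := by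
  unfold lkM
  rw [← Set.image_univ, MvPolynomial.mem_ideal_span_X_image]
  constructor
  · intro H
    by_contra hc
    obtain ⟨i, -, hi⟩ := H 0 (MvPolynomial.mem_support_iff.2 hc)
    simp at hi
  · intro H m hm
    by_contra! hc
    have : m = 0 := by ext i; simpa using hc i (Set.mem_univ i)
    rw [this, MvPolynomial.mem_support_iff] at hm
    exact hm H

theorem lk_hom_mem_M {K : Type*} [Field K] {h : MvPolynomial (Fin 4) K} {e : ℕ}
    (hh : h.IsHomogeneous e) (he : 0 < e) : h ∈ lkM K := by
  rw [lk_mem_M]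
  apply hh.coeff_eq_zero
  simp; omega

theorem lk_exch_soc {K : Type*} [Field K] {B : Ideal (MvPolynomial (Fin 4) K)}
    {h k : MvPolynomial (Fin 4) K} (hh : lkNZ B h) (hk : lkNZ B k) (hm : h ∈ lkM K)
    (hS : lkSoc (lkJ B h)) : lkSoc (lkJ B k) := by
  intro x hx
  obtain ⟨b, hb, c, hc⟩ := lk_mem_J.1 (lk_mul_mem_of_mem_M hm hx)
  have hcJ : c ∈ lkJ B h := by
    apply hS
    intro i
    obtain ⟨bi, hbi, ci, hci⟩ := lk_mem_J.1 (hx i)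
    have h1 : k * (MvPolynomial.X i * c - h * ci) ∈ B := by
      have : k * (MvPolynomial.X i * c - h * ci) = h * bi - MvPolynomial.X i * b := by
        linear_combination (-MvPolynomial.X i) * hc + h * hci
      rw [this]
      exact B.sub_mem (B.mul_mem_left _ hbi) (B.mul_mem_left _ hb)
    exact lk_mem_J.2 ⟨_, hk _ h1, ci, by ring⟩
  obtain ⟨b', hb', c', rfl⟩ := lk_mem_J.1 hcJ
  have h2 : h * (x - k * c') ∈ B := by
    have : h * (x - k * c') = b + k * b' := by linear_combination hc
    rw [this]
    exact B.add_mem hb (B.mul_mem_left _ hb')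
  exact lk_mem_J.2 ⟨_, hh _ h2, c', by ring⟩

/-- Base case: variables. -/
theorem lk_NZ_X {K : Type*} [Field K] (s : Set (Fin 4)) (i : Fin 4) (hi : i ∉ s) :
    lkNZ (Ideal.span (MvPolynomial.X '' s : Set (MvPolynomial (Fin 4) K))) (MvPolynomial.X i) := by
  intro x hx
  rw [MvPolynomial.mem_ideal_span_X_image] at hx ⊢
  intro m hm
  obtain ⟨j, hj, hj2⟩ := hx (Finsupp.single i 1 + m) (by
    rw [MvPolynomial.mem_support_iff, MvPolynomial.coeff_X_mul]
    exact MvPolynomial.mem_support_iff.1 hm)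
  refine ⟨j, hj, ?_⟩
  have : i ≠ j := fun h => hi (h ▸ hj)
  simpa [Finsupp.single_apply, this] using hj2

theorem lk_soc_of_NZ {K : Type*} [Field K] {B : Ideal (MvPolynomial (Fin 4) K)} (i : Fin 4)
    (h : lkNZ B (MvPolynomial.X i)) : lkSoc B := fun x hx => h x (hx i)

theorem lk_avoid_aux {K : Type*} [Field K] {P : Ideal (MvPolynomial (Fin 4) K)}
    (hP : P.IsPrime) (hPh : lkHom P) (hPm : ¬ lkM K ≤ P)
    (Γ : Finset (Ideal (MvPolynomial (Fin 4) K))) (hΓ : ∀ Q ∈ Γ, lkHom Q ∧ ¬ Q ≤ P) :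
    ∃ (v : MvPolynomial (Fin 4) K) (f : ℕ), v.IsHomogeneous f ∧ 0 < f ∧ v ∉ P ∧
      ∀ Q ∈ Γ, v ∈ Q := by
  classical
  induction Γ using Finset.induction_on with
  | empty =>
    have : ∃ i : Fin 4, (MvPolynomial.X i : MvPolynomial (Fin 4) K) ∉ P := by
      by_contra! hc
      apply hPm
      unfold lkM
      rw [Ideal.span_le]
      rintro _ ⟨i, rfl⟩
      exact hc i
    obtain ⟨i, hi⟩ := this
    exact ⟨_, 1, MvPolynomial.isHomogeneous_X K i, one_pos, hi, by simp⟩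
  | insert Q Γ hQ ih =>
    obtain ⟨v, f, hv, hf, hvP, hvΓ⟩ := ih (fun Q hQ => hΓ Q (Finset.mem_insert_of_mem hQ))
    obtain ⟨hQh, hQP⟩ := hΓ Q (Finset.mem_insert_self _ _)
    obtain ⟨x, hxQ, hxP⟩ := Set.not_subset.1 hQP
    have hxP' : x ∉ P := hxP
    rw [MvPolynomial.mem_iff_homogeneousComponent_mem hPh] at hxP'
    push Not at hxP'
    obtain ⟨n, hn⟩ := hxP'
    refine ⟨v * MvPolynomial.homogeneousComponent n x, f + n,
      hv.mul (MvPolynomial.homogeneousComponent_isHomogeneous n x), by omega, ?_, ?_⟩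
    · intro hc
      rcases hP.mem_or_mem hc with h | h
      · exact hvP h
      · exact hn h
    · intro Q' hQ'
      rcases Finset.mem_insert.1 hQ' with rfl | hQ'
      · exact Ideal.mul_mem_left _ _ (MvPolynomial.homogeneousComponent_mem_of_mem hQh hxQ n)
      · exact Ideal.mul_mem_right _ _ (hvΓ Q' hQ')

theorem lk_avoid_primes {K : Type*} [Field K] (Γ : Finset (Ideal (MvPolynomial (Fin 4) K)))
    (hΓ : ∀ Q ∈ Γ, Q.IsPrime ∧ lkHom Q ∧ ¬ lkM K ≤ Q) :
    ∃ (u : MvPolynomial (Fin 4) K) (e : ℕ), u.IsHomogeneous e ∧ 0 < e ∧ ∀ Q ∈ Γ, u ∉ Q := by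
  classical
  induction Γ using Finset.strongInduction with
  | H Γ ih =>
    rcases Γ.eq_empty_or_nonempty with rfl | hne
    · exact ⟨_, 1, MvPolynomial.isHomogeneous_X K 0, one_pos, by simp⟩
    obtain ⟨P, hPmin⟩ := Γ.exists_minimal hne
    have hPΓ : P ∈ Γ := hPmin.1
    obtain ⟨hP, hPh, hPm⟩ := hΓ P hPΓ
    obtain ⟨u, e, hu, he, huΓ⟩ := ih (Γ.erase P) (Finset.erase_ssubset hPΓ)
      (fun Q hQ => hΓ Q (Finset.mem_of_mem_erase hQ))
    by_cases huP : u ∈ P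
    · obtain ⟨v, f, hv, hf, hvP, hvΓ⟩ := lk_avoid_aux hP hPh hPm (Γ.erase P) (fun Q hQ =>
        ⟨(hΓ Q (Finset.mem_of_mem_erase hQ)).2.1, fun hle => Finset.ne_of_mem_erase hQ
          (le_antisymm hle (hPmin.2 (Finset.mem_of_mem_erase hQ) hle))⟩)
      refine ⟨u ^ f + v ^ e, e * f, (hu.pow f).add (by rw [mul_comm]; exact hv.pow e),
        Nat.mul_pos he hf, ?_⟩
      intro Q hQ hc
      by_cases hQP : Q = P
      · subst hQP
        have h1 : v ^ e ∈ Q := by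
          have h0 := Ideal.pow_mem_of_mem Q huP f hf
          have := Q.sub_mem hc h0
          simpa using this
        exact hvP (hP.mem_of_pow_mem _ h1)
      · have hQ' : Q ∈ Γ.erase P := Finset.mem_erase.2 ⟨hQP, hQ⟩
        have h1 : u ^ f ∈ Q := by
          have h0 := Ideal.pow_mem_of_mem Q (hvΓ Q hQ') e he
          have := Q.sub_mem hc h0
          simpa using this
        exact huΓ Q hQ' ((hΓ Q hQ).1.mem_of_pow_mem _ h1)
    · refine ⟨u, e, hu, he, ?_⟩
      intro Q hQ
      by_cases hQP : Q = P
      · rwa [hQP]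
      · exact huΓ Q (Finset.mem_erase.2 ⟨hQP, hQ⟩)

/-- Homogeneous nonzerodivisors of large degree modulo finitely many ideals of positive depth. -/
theorem lk_avoid {K : Type*} [Field K] (L : List (Ideal (MvPolynomial (Fin 4) K)))
    (hL : ∀ B ∈ L, lkSoc B) (D : ℕ) :
    ∃ (U : MvPolynomial (Fin 4) K) (m : ℕ), U.IsHomogeneous m ∧ 0 < m ∧ D ≤ m ∧
      ∀ B ∈ L, lkNZ B U := by
  classical
  let S : Set (Ideal (MvPolynomial (Fin 4) K)) :=
    ⋃ B ∈ {B | B ∈ L}, associatedPrimes (MvPolynomial (Fin 4) K) (MvPolynomial (Fin 4) K ⧸ B)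
  have hS : S.Finite := by
    apply Set.Finite.biUnion (List.finite_toSet L)
    intro B _
    exact associatedPrimes.finite _ _
  let Γ : Finset (Ideal (MvPolynomial (Fin 4) K)) := hS.toFinset.image fun P =>
    (P.homogeneousCore (MvPolynomial.homogeneousSubmodule (Fin 4) K)).toIdeal
  obtain ⟨u, e, hu, he, huΓ⟩ := lk_avoid_primes Γ (by
    intro Q hQ
    obtain ⟨P, hPS, rfl⟩ := Finset.mem_image.1 hQ
    rw [Set.Finite.mem_toFinset] at hPS
    simp only [S, Set.mem_iUnion, Set.mem_ofPred_eq] at hPS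
    obtain ⟨B, hBL, hPB⟩ := hPS
    refine ⟨Ideal.IsPrime.homogeneousCore hPB.1, HomogeneousIdeal.isHomogeneous _, ?_⟩
    intro hm
    have hm' := hm.trans (Ideal.toIdeal_homogeneousCore_le _ _)
    obtain ⟨hP, x, hx⟩ := isAssociatedPrime_iff.1 hPB
    obtain ⟨y, rfl⟩ := Ideal.Quotient.mk_surjective x
    have : y ∈ B := by
      apply hL B hBL
      intro i
      have h1 : (MvPolynomial.X i : MvPolynomial (Fin 4) K) ∈ P :=
        hm' (Ideal.subset_span ⟨i, rfl⟩)
      rw [hx, Submodule.mem_colon_singleton, Submodule.mem_bot] at h1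
      rw [← Ideal.Quotient.eq_zero_iff_mem, map_mul]
      exact h1
    rw [Ideal.Quotient.eq_zero_iff_mem.2 this] at hx
    apply hP.ne_top
    rw [hx]
    ext z
    simp)
  have hnz : ∀ B ∈ L, lkNZ B u := by
    intro B hB x hx
    by_contra hxB
    obtain ⟨P, hP, hle⟩ := exists_le_isAssociatedPrime_of_isNoetherianRing
      (MvPolynomial (Fin 4) K) (Ideal.Quotient.mk B x)
      (fun h => hxB (Ideal.Quotient.eq_zero_iff_mem.1 h))
    have huP : u ∈ P := by
      apply hle
      rw [Submodule.mem_colon_singleton, Submodule.mem_bot]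
      change Ideal.Quotient.mk B (u * x) = 0
      exact Ideal.Quotient.eq_zero_iff_mem.2 hx
    refine huΓ _ (Finset.mem_image.2 ⟨P, ?_, rfl⟩)
      (Ideal.mem_homogeneousCore_of_homogeneous_of_mem ⟨e, hu⟩ huP)
    rw [Set.Finite.mem_toFinset]
    simp only [S, Set.mem_iUnion, Set.mem_ofPred_eq]
    exact ⟨B, hB, hP⟩
  refine ⟨u ^ (D + 1), e * (D + 1), hu.pow _, Nat.mul_pos he (Nat.succ_pos _), by nlinarith, ?_⟩
  intro B hB
  exact (hnz B hB).pow _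

/-- The degree-`j` part of an ideal. -/
noncomputable def lkD {K : Type*} [Field K] (A : Ideal (MvPolynomial (Fin 4) K)) (j : ℕ) :
    Submodule K (MvPolynomial.homogeneousSubmodule (Fin 4) K j) :=
  Submodule.comap (MvPolynomial.homogeneousSubmodule (Fin 4) K j).subtype
        (Submodule.restrictScalars K (A : Submodule (MvPolynomial (Fin 4) K) (MvPolynomial (Fin 4) K)))

theorem lk_mem_D {K : Type*} [Field K] {A : Ideal (MvPolynomial (Fin 4) K)} {j : ℕ}
    {x : MvPolynomial.homogeneousSubmodule (Fin 4) K j} :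
    x ∈ lkD A j ↔ (x : MvPolynomial (Fin 4) K) ∈ A := Iff.rfl

instance lk_fin {K : Type*} [Field K] (j : ℕ) :
    Module.Finite K (MvPolynomial.homogeneousSubmodule (Fin 4) K j) :=
  Module.Finite.iff_fg.2 (MvPolynomial.homogeneousSubmodule_fg (Fin 4) K j)

theorem lk_hilb_add {K : Type*} [Field K] (A : Ideal (MvPolynomial (Fin 4) K)) (j : ℕ) :
    hilbFn A j + Module.finrank K (lkD A j) =
      Module.finrank K (MvPolynomial.homogeneousSubmodule (Fin 4) K j) :=
  Submodule.finrank_quotient_add_finrank (lkD A j)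

/-- Multiplication by a homogeneous element on graded pieces. -/
noncomputable def lkMul {K : Type*} [Field K] {h : MvPolynomial (Fin 4) K} {e : ℕ}
    (hh : h.IsHomogeneous e) (i j : ℕ) (hij : e + i = j) :
    MvPolynomial.homogeneousSubmodule (Fin 4) K i →ₗ[K]
      MvPolynomial.homogeneousSubmodule (Fin 4) K j :=
  LinearMap.restrict (LinearMap.mulLeft K h) (fun x hx => by
    subst hij
    exact hh.mul hx)

theorem lk_mul_coe {K : Type*} [Field K] {h : MvPolynomial (Fin 4) K} {e : ℕ}
    (hh : h.IsHomogeneous e) (i j : ℕ) (hij : e + i = j)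
    (x : MvPolynomial.homogeneousSubmodule (Fin 4) K i) :
    (lkMul hh i j hij x : MvPolynomial (Fin 4) K) = h * x := rfl

/-- Multiplication on graded pieces of the quotient. -/
noncomputable def lkMulQ {K : Type*} [Field K] (B : Ideal (MvPolynomial (Fin 4) K))
    {h : MvPolynomial (Fin 4) K} {e : ℕ}
    (hh : h.IsHomogeneous e) (i j : ℕ) (hij : e + i = j) :
    (MvPolynomial.homogeneousSubmodule (Fin 4) K i ⧸ lkD B i) →ₗ[K]
      (MvPolynomial.homogeneousSubmodule (Fin 4) K j ⧸ lkD B j) :=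
  Submodule.mapQ _ _ (lkMul hh i j hij) (fun x hx => by
    rw [Submodule.mem_comap, lk_mem_D, lk_mul_coe]
    exact B.mul_mem_left _ hx)

theorem lk_mulQ_inj {K : Type*} [Field K] {B : Ideal (MvPolynomial (Fin 4) K)}
    {h : MvPolynomial (Fin 4) K} {e : ℕ}
    (hh : h.IsHomogeneous e) (hN : lkNZ B h) (i j : ℕ) (hij : e + i = j) :
    Function.Injective (lkMulQ B hh i j hij) := by
  rw [← LinearMap.ker_eq_bot, LinearMap.ker_eq_bot']
  intro x hx
  obtain ⟨y, rfl⟩ := Submodule.mkQ_surjective _ x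
  simp only [lkMulQ, Submodule.mkQ_apply, Submodule.mapQ_apply, Submodule.Quotient.mk_eq_zero] at hx ⊢
  rw [lk_mem_D] at hx ⊢
  exact hN _ hx

theorem lk_mulQ_surj_iff {K : Type*} [Field K] {B : Ideal (MvPolynomial (Fin 4) K)} (hB : lkHom B)
    {h : MvPolynomial (Fin 4) K} {e : ℕ}
    (hh : h.IsHomogeneous e) (i j : ℕ) (hij : e + i = j) :
    Function.Surjective (lkMulQ B hh i j hij) ↔
      ∀ x : MvPolynomial (Fin 4) K, x.IsHomogeneous j → x ∈ lkJ B h := by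
  constructor
  · intro H x hx
    obtain ⟨y, hy⟩ := H (Submodule.mkQ _ ⟨x, hx⟩)
    obtain ⟨z, rfl⟩ := Submodule.mkQ_surjective _ y
    simp only [lkMulQ, Submodule.mkQ_apply, Submodule.mapQ_apply] at hy
    rw [Submodule.Quotient.eq, lk_mem_D] at hy
    exact lk_mem_J.2 ⟨_, B.neg_mem hy, z, by simp [lk_mul_coe]⟩
  · intro H x
    obtain ⟨⟨y, hy⟩, rfl⟩ := Submodule.mkQ_surjective _ x
    obtain ⟨b, hb, c, hc⟩ := lk_mem_J.1 (H y hy)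
    refine ⟨Submodule.mkQ _ ⟨MvPolynomial.homogeneousComponent i c,
      MvPolynomial.homogeneousComponent_isHomogeneous i c⟩, ?_⟩
    simp only [lkMulQ, Submodule.mkQ_apply, Submodule.mapQ_apply]
    rw [Submodule.Quotient.eq, lk_mem_D]
    have h1 : MvPolynomial.homogeneousComponent j b ∈ B :=
      MvPolynomial.homogeneousComponent_mem_of_mem hB hb j
    have h2 := congrArg (MvPolynomial.homogeneousComponent j) hc
    rw [MvPolynomial.homogeneousComponent_eq_self hy, map_add] at h2
    have h3 := lk_comp_mul hh i c
    rw [hij] at h3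
    rw [h3] at h2
    have : (((lkMul hh i j hij) ⟨MvPolynomial.homogeneousComponent i c,
      MvPolynomial.homogeneousComponent_isHomogeneous i c⟩ - ⟨y, hy⟩ :
        MvPolynomial.homogeneousSubmodule (Fin 4) K j) : MvPolynomial (Fin 4) K) =
        - MvPolynomial.homogeneousComponent j b := by
      rw [Submodule.coe_sub, lk_mul_coe]
      simp only
      rw [h2]; ring
    rw [this]
    exact B.neg_mem h1

theorem lk_hilb_le {K : Type*} [Field K] {B : Ideal (MvPolynomial (Fin 4) K)}
    {h : MvPolynomial (Fin 4) K} {e : ℕ}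
    (hh : h.IsHomogeneous e) (hN : lkNZ B h) (i : ℕ) : hilbFn B i ≤ hilbFn B (e + i) :=
  LinearMap.finrank_le_finrank_of_injective (lk_mulQ_inj hh hN i _ rfl)

theorem lk_hilb_eq_iff {K : Type*} [Field K] {B : Ideal (MvPolynomial (Fin 4) K)} (hB : lkHom B)
    {h : MvPolynomial (Fin 4) K} {e : ℕ}
    (hh : h.IsHomogeneous e) (hN : lkNZ B h) (i : ℕ) : hilbFn B i = hilbFn B (e + i) ↔
      ∀ x : MvPolynomial (Fin 4) K, x.IsHomogeneous (e + i) → x ∈ lkJ B h := by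
  rw [← lk_mulQ_surj_iff hB hh i _ rfl]
  constructor
  · intro H
    exact (LinearMap.injective_iff_surjective_of_finrank_eq_finrank H).1 (lk_mulQ_inj hh hN i _ rfl)
  · intro H
    exact (LinearEquiv.ofBijective _ ⟨lk_mulQ_inj hh hN i _ rfl, H⟩).finrank_eq

/-- Transfer of finite length along an exchange of parameters. -/
theorem lk_exch_fin {K : Type*} [Field K] {B : Ideal (MvPolynomial (Fin 4) K)} (hB : lkHom B)
    {h k : MvPolynomial (Fin 4) K} {e f : ℕ} (hh : h.IsHomogeneous e) (hk : k.IsHomogeneous f)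
    (he : 0 < e) (hNh : lkNZ B h) (hNk : lkNZ B k) (n : ℕ)
    (H : ∀ j ≥ n, ∀ x : MvPolynomial (Fin 4) K, x.IsHomogeneous j → x ∈ lkJ B h) :
    ∀ j ≥ n + f, ∀ x : MvPolynomial (Fin 4) K, x.IsHomogeneous j → x ∈ lkJ B k := by
  intro j hj
  obtain ⟨i, rfl⟩ : ∃ i, j = f + i := ⟨j - f, by omega⟩
  rw [← lk_hilb_eq_iff hB hk hNk]
  have h1 : ∀ r, hilbFn B i = hilbFn B (r * e + i) := by
    intro r
    induction r with
    | zero => simp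
    | succ r ih =>
      rw [ih, (lk_hilb_eq_iff hB hh hNh (r * e + i)).2 (H _ (by nlinarith))]
      congr 1; ring
  have h2 : ∀ r, hilbFn B (f + i) ≤ hilbFn B ((r + 1) * f + i) := by
    intro r
    induction r with
    | zero => simp
    | succ r ih =>
      refine ih.trans ((lk_hilb_le hk hNk _).trans (le_of_eq ?_))
      congr 1; ring
  have h3 := h2 (e - 1)
  rw [Nat.sub_add_cancel he, mul_comm, ← h1 f] at h3
  exact le_antisymm (lk_hilb_le hk hNk i) h3

/-- `Q` is the annihilator of a homogeneous functional of degree `s`. -/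
def lkGor {K : Type*} [Field K] (Q : Ideal (MvPolynomial (Fin 4) K)) (s : ℕ) : Prop :=
  ∃ l : MvPolynomial (Fin 4) K →ₗ[K] K,
    (∀ n, n ≠ s → ∀ x : MvPolynomial (Fin 4) K, x.IsHomogeneous n → l x = 0) ∧
    ∀ x, x ∈ Q ↔ ∀ z, l (x * z) = 0

theorem lk_gor_high {K : Type*} [Field K] {Q : Ideal (MvPolynomial (Fin 4) K)} {s : ℕ}
    (hQ : lkGor Q s) {j : ℕ} (hj : s + 1 ≤ j) (x : MvPolynomial (Fin 4) K)
    (hx : x.IsHomogeneous j) : x ∈ Q := by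
  obtain ⟨l, hl, hlQ⟩ := hQ
  rw [hlQ]
  intro z
  induction z using MvPolynomial.induction_on' with
  | monomial d r =>
    exact hl _ (by omega) _ (hx.mul (MvPolynomial.isHomogeneous_monomial (n := d.degree) r rfl))
  | add p q hp hq => simp [mul_add, hp, hq]

theorem lk_exists_socle {K : Type*} [Field K] {J : Ideal (MvPolynomial (Fin 4) K)} {n : ℕ}
    (hJ : ∀ j ≥ n, ∀ x : MvPolynomial (Fin 4) K, x.IsHomogeneous j → x ∈ J)
    {x : MvPolynomial (Fin 4) K} (hx : x ∉ J) :
    ∃ z, x * z ∉ J ∧ ∀ i, MvPolynomial.X i * (x * z) ∈ J := by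
  by_contra! hc
  have key : ∀ r : ℕ, ∃ z : MvPolynomial (Fin 4) K, z.IsHomogeneous r ∧ x * z ∉ J := by
    intro r
    induction r with
    | zero => exact ⟨1, MvPolynomial.isHomogeneous_one _ _, by simpa using hx⟩
    | succ r ih =>
      obtain ⟨z, hz, hxz⟩ := ih
      obtain ⟨i, hi⟩ := hc z hxz
      refine ⟨z * MvPolynomial.X i, hz.mul (MvPolynomial.isHomogeneous_X K i), ?_⟩
      convert hi using 1
      ring_nf
  obtain ⟨z, hz, hxz⟩ := key n
  exact hxz (J.mul_mem_left _ (hJ n le_rfl z hz))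

theorem lk_factor {K V W : Type*} [Field K] [AddCommGroup V] [Module K V] [AddCommGroup W]
    [Module K W] (f : V →ₗ[K] W) (l : V →ₗ[K] K) (h : ∀ x, f x = 0 → l x = 0) :
    ∃ g : W →ₗ[K] K, ∀ x, g (f x) = l x := by
  have hr : l ∈ LinearMap.range f.dualMap := by
    rw [LinearMap.range_dualMap_eq_dualAnnihilator_ker, Submodule.mem_dualAnnihilator]
    intro x hx
    exact h x hx
  obtain ⟨g, rfl⟩ := hr
  exact ⟨g, fun x => rfl⟩

theorem lk_exch_gor {K : Type*} [Field K] {B : Ideal (MvPolynomial (Fin 4) K)} (hB : lkHom B)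
    {h k : MvPolynomial (Fin 4) K} {e f s s' : ℕ} (hh : h.IsHomogeneous e)
    (hk : k.IsHomogeneous f) (he : 0 < e) (hNh : lkNZ B h) (hNk : lkNZ B k)
    (hs : s' + e = s + f) (hG : lkGor (lkJ B h) s) : lkGor (lkJ B k) s' := by
  have hfin := lk_exch_fin hB hh hk he hNh hNk (s + 1)
    (fun j hj x hx => lk_gor_high hG hj x hx)
  obtain ⟨l, hl, hlQ⟩ := hG
  have hlB : ∀ x ∈ B, l x = 0 := fun x hx => by
    simpa using (hlQ x).1 (lk_le_J B h hx) 1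
  obtain ⟨g, hg⟩ := lk_factor
    ((Submodule.mkQ (Submodule.restrictScalars K B)).comp (LinearMap.mulLeft K k)) l (by
      intro x hx
      simp only [LinearMap.comp_apply, LinearMap.mulLeft_apply, Submodule.mkQ_apply,
        Submodule.Quotient.mk_eq_zero, Submodule.restrictScalars_mem] at hx
      exact hlB x (hNk x hx))
  -- the homogenized functional
  let l' : MvPolynomial (Fin 4) K →ₗ[K] K :=
    (g.comp (Submodule.mkQ (Submodule.restrictScalars K B))).comp
      (MvPolynomial.homogeneousComponent (f + s))
  have hl'B : ∀ x ∈ B, l' x = 0 := by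
    intro x hx
    have : (Submodule.mkQ (Submodule.restrictScalars K B))
        (MvPolynomial.homogeneousComponent (f + s) x) = 0 := by
      rw [Submodule.mkQ_apply, Submodule.Quotient.mk_eq_zero]
      exact MvPolynomial.homogeneousComponent_mem_of_mem hB hx _
    simp only [l', LinearMap.comp_apply, this, map_zero]
  have hlcomp : ∀ x, l (MvPolynomial.homogeneousComponent s x) = l x := by
    intro x
    induction x using MvPolynomial.induction_on' with
    | monomial d r =>
      have h1 := MvPolynomial.isHomogeneous_monomial (n := d.degree) r rfl
      rw [MvPolynomial.homogeneousComponent_of_mem h1]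
      split_ifs with hd
      · rfl
      · rw [map_zero, hl _ (Ne.symm hd) _ h1]
    | add p q hp hq => simp [hp, hq]
  have hl'k : ∀ x, l' (k * x) = l x := by
    intro x
    rw [← hlcomp x, ← hg]
    simp only [l', LinearMap.comp_apply, LinearMap.mulLeft_apply]
    rw [lk_comp_mul hk]
  refine ⟨l'.comp (LinearMap.mulLeft K h), ?_, ?_⟩
  · intro n hn x hx
    simp only [l', LinearMap.comp_apply, LinearMap.mulLeft_apply]
    rw [MvPolynomial.homogeneousComponent_of_mem (hh.mul hx), if_neg (by omega), map_zero, map_zero]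
  · intro x
    constructor
    · intro hx z
      obtain ⟨b, hb, c, rfl⟩ := lk_mem_J.1 hx
      have h1 : h * ((b + k * c) * z) = b * (h * z) + k * (h * (c * z)) := by ring
      rw [LinearMap.comp_apply, LinearMap.mulLeft_apply, h1, map_add,
        hl'B _ (B.mul_mem_right _ hb), hl'k, zero_add]
      have := (hlQ h).1 (lk_self_mem_J B h) (c * z)
      exact this
    · intro H
      by_contra hx
      obtain ⟨z, hz, hzi⟩ := lk_exists_socle hfin hx
      obtain ⟨b, hb, c, hc⟩ := lk_mem_J.1 (lk_mul_mem_of_mem_M (lk_hom_mem_M hh he) hzi)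
      have hcJ : c ∉ lkJ B h := by
        intro hcJ
        obtain ⟨b', hb', c', rfl⟩ := lk_mem_J.1 hcJ
        apply hz
        have h2 : h * (x * z - k * c') ∈ B := by
          have : h * (x * z - k * c') = b + k * b' := by linear_combination hc
          rw [this]
          exact B.add_mem hb (B.mul_mem_left _ hb')
        exact lk_mem_J.2 ⟨_, hNh _ h2, c', by ring⟩
      apply hcJ
      rw [hlQ]
      intro r
      have h3 := H (z * r)
      rw [LinearMap.comp_apply, LinearMap.mulLeft_apply] at h3
      have h4 : h * (x * (z * r)) = b * r + k * (c * r) := by linear_combination r * hc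
      rw [h4, map_add, hl'B _ (B.mul_mem_right _ hb), hl'k, zero_add] at h3
      exact h3

/-- The ideal generated by a set of variables. -/
theorem lk_J_X {K : Type*} [Field K] (s : Set (Fin 4)) (i : Fin 4) :
    lkJ (Ideal.span (MvPolynomial.X '' s : Set (MvPolynomial (Fin 4) K))) (MvPolynomial.X i) =
      Ideal.span (MvPolynomial.X '' (insert i s)) := by
  rw [lkJ, Set.image_insert_eq, Set.insert_eq, Ideal.span_union, sup_comm]

theorem lk_gor_M {K : Type*} [Field K] : lkGor (lkM K) 0 := by
  refine ⟨MvPolynomial.lcoeff K 0, ?_, ?_⟩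
  · intro n hn x hx
    exact hx.coeff_eq_zero (by simpa using hn.symm)
  · intro x
    rw [lk_mem_M]
    constructor
    · intro h z
      change MvPolynomial.coeff 0 (x * z) = 0
      rw [← lk_mem_M] at h ⊢
      exact Ideal.mul_mem_right _ _ h
    · intro H
      have := H 1
      rwa [mul_one] at this

/-- Existence of parameters with a dualizing functional. -/
theorem lk_params {K : Type*} [Field K] {F G : MvPolynomial (Fin 4) K} {a b : ℕ}
    (hF : F.IsHomogeneous a) (hG : G.IsHomogeneous b) (ha : 0 < a) (hb : 0 < b)
    (hNF : lkNZ ⊥ F) (hNG : lkNZ (lkJ ⊥ F) G) (D : ℕ) :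
    ∃ (U V : MvPolynomial (Fin 4) K) (m n s : ℕ), U.IsHomogeneous m ∧ V.IsHomogeneous n ∧
      D ≤ m ∧ D ≤ n ∧ s + 4 = a + b + m + n ∧ lkNZ (lkJ (lkJ ⊥ F) G) U ∧
      lkNZ (lkJ (lkJ (lkJ ⊥ F) G) U) V ∧ lkGor (lkJ (lkJ (lkJ (lkJ ⊥ F) G) U) V) s := by
  let x : Fin 4 → MvPolynomial (Fin 4) K := MvPolynomial.X
  have hx : ∀ i, (x i).IsHomogeneous 1 := fun i => MvPolynomial.isHomogeneous_X K i
  have hxM : ∀ i, x i ∈ lkM K := fun i => lk_hom_mem_M (hx i) one_pos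
  have hFM := lk_hom_mem_M hF ha
  have hGM := lk_hom_mem_M hG hb
  have e0 : (⊥ : Ideal (MvPolynomial (Fin 4) K)) = Ideal.span (MvPolynomial.X '' ∅) := by simp
  have e1 : lkJ ⊥ (x 0) = Ideal.span (MvPolynomial.X '' {0}) := by
    rw [e0, lk_J_X]; simp
  have e2 : lkJ (lkJ ⊥ (x 0)) (x 1) = Ideal.span (MvPolynomial.X '' {1, 0}) := by
    rw [e1, lk_J_X]
  have e3 : lkJ (lkJ (lkJ ⊥ (x 0)) (x 1)) (x 2) = Ideal.span (MvPolynomial.X '' {2, 1, 0}) := by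
    rw [e2, lk_J_X]
  have e4 : lkJ (lkJ (lkJ (lkJ ⊥ (x 0)) (x 1)) (x 2)) (x 3) = lkM K := by
    rw [e3, lk_J_X, lkM, ← Set.image_univ]
    congr 2
    ext i
    fin_cases i <;> simp
  have n0 : lkNZ ⊥ (x 0) := by rw [e0]; exact lk_NZ_X _ _ (by simp)
  have n1 : lkNZ (lkJ ⊥ (x 0)) (x 1) := by rw [e1]; exact lk_NZ_X _ _ (by simp)
  have n2 : lkNZ (lkJ (lkJ ⊥ (x 0)) (x 1)) (x 2) := by rw [e2]; exact lk_NZ_X _ _ (by simp)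
  have n3 : lkNZ (lkJ (lkJ (lkJ ⊥ (x 0)) (x 1)) (x 2)) (x 3) := by
    rw [e3]; exact lk_NZ_X _ _ (by decide)
  -- depth of one-generated ideals
  have sX : lkSoc (lkJ ⊥ (x 0)) := lk_soc_of_NZ 1 n1
  have sF : lkSoc (lkJ ⊥ F) := lk_exch_soc n0 hNF (hxM 0) sX
  obtain ⟨W, w, hW, hw, -, hWN⟩ := lk_avoid [lkJ ⊥ (x 0), lkJ ⊥ F] (by simp [sX, sF]) 0
  have hWM := lk_hom_mem_M hW hw
  simp only [List.mem_cons, List.not_mem_nil, or_false, forall_eq_or_imp, forall_eq] at hWN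
  obtain ⟨W1, W2⟩ := hWN
  have B0 : lkHom (⊥ : Ideal (MvPolynomial (Fin 4) K)) := lkHom.bot
  have BX := B0.J (hx 0)
  have BF := B0.J hF
  have BW := B0.J hW
  -- depth of two-generated ideals
  have sXX : lkSoc (lkJ (lkJ ⊥ (x 0)) (x 1)) := lk_soc_of_NZ 2 n2
  have sXW : lkSoc (lkJ (lkJ ⊥ (x 0)) W) := lk_exch_soc n1 W1 (hxM 1) sXX
  have wx : lkNZ (lkJ ⊥ W) (x 0) := lk_swap n0 W1
  have wF : lkNZ (lkJ ⊥ W) F := lk_swap hNF W2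
  have sFW : lkSoc (lkJ (lkJ ⊥ F) W) := by
    rw [lk_J_comm] at sXW ⊢
    exact lk_exch_soc wx wF (hxM 0) sXW
  have sFG : lkSoc (lkJ (lkJ ⊥ F) G) := lk_exch_soc W2 hNG hWM sFW
  obtain ⟨U, m, hU, hm, hDm, hUN⟩ := lk_avoid [lkJ (lkJ ⊥ (x 0)) (x 1), lkJ (lkJ ⊥ (x 0)) W,
    lkJ (lkJ ⊥ F) W, lkJ (lkJ ⊥ F) G] (by simp [sXX, sXW, sFW, sFG]) D
  have hUM := lk_hom_mem_M hU hm
  simp only [List.mem_cons, List.not_mem_nil, or_false, forall_eq_or_imp, forall_eq] at hUN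
  obtain ⟨U1, U2, U3, U4⟩ := hUN
  -- depth of three-generated ideals
  have sXXX : lkSoc (lkJ (lkJ (lkJ ⊥ (x 0)) (x 1)) (x 2)) := lk_soc_of_NZ 3 n3
  have sXXU : lkSoc (lkJ (lkJ (lkJ ⊥ (x 0)) (x 1)) U) := lk_exch_soc n2 U1 (hxM 2) sXXX
  have a1 : lkNZ (lkJ (lkJ ⊥ (x 0)) U) (x 1) := lk_swap n1 U1
  have a2 : lkNZ (lkJ (lkJ ⊥ (x 0)) U) W := lk_swap W1 U2
  have sXWU : lkSoc (lkJ (lkJ (lkJ ⊥ (x 0)) W) U) := by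
    rw [lk_J_comm] at sXXU ⊢
    exact lk_exch_soc a1 a2 (hxM 1) sXXU
  have a3 : lkNZ (lkJ (lkJ ⊥ W) U) (x 0) := lk_swap wx (by rw [lk_J_comm]; exact U2)
  have a4 : lkNZ (lkJ (lkJ ⊥ W) U) F := lk_swap wF (by rw [lk_J_comm]; exact U3)
  have sFWU : lkSoc (lkJ (lkJ (lkJ ⊥ F) W) U) := by
    rw [lk_J_comm ⊥, lk_J_comm (lkJ ⊥ W)] at sXWU ⊢
    exact lk_exch_soc a3 a4 (hxM 0) sXWU
  have a5 : lkNZ (lkJ (lkJ ⊥ F) U) W := lk_swap W2 U3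
  have a6 : lkNZ (lkJ (lkJ ⊥ F) U) G := lk_swap hNG U4
  have sFGU : lkSoc (lkJ (lkJ (lkJ ⊥ F) G) U) := by
    rw [lk_J_comm] at sFWU ⊢
    exact lk_exch_soc a5 a6 hWM sFWU
  obtain ⟨V, n, hV, hn, hDn, hVN⟩ := lk_avoid [lkJ (lkJ (lkJ ⊥ (x 0)) (x 1)) (x 2),
    lkJ (lkJ (lkJ ⊥ (x 0)) (x 1)) U, lkJ (lkJ (lkJ ⊥ (x 0)) W) U, lkJ (lkJ (lkJ ⊥ F) W) U,
    lkJ (lkJ (lkJ ⊥ F) G) U] (by simp [sXXX, sXXU, sXWU, sFWU, sFGU]) D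
  simp only [List.mem_cons, List.not_mem_nil, or_false, forall_eq_or_imp, forall_eq] at hVN
  obtain ⟨V1, V2, V3, V4, V5⟩ := hVN
  -- the chain of exchanges
  have g0 : lkGor (lkJ (lkJ (lkJ (lkJ ⊥ (x 0)) (x 1)) (x 2)) (x 3)) 0 := by
    rw [e4]; exact lk_gor_M
  have g1 : lkGor (lkJ (lkJ (lkJ (lkJ ⊥ (x 0)) (x 1)) (x 2)) V) (n - 1) :=
    lk_exch_gor ((BX.J (hx 1)).J (hx 2)) (hx 3) hV one_pos n3 V1 (by omega) g0
  have g2 : lkGor (lkJ (lkJ (lkJ (lkJ ⊥ (x 0)) (x 1)) U) V) (m + n - 2) := by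
    rw [lk_J_comm (lkJ (lkJ ⊥ (x 0)) (x 1))] at g1 ⊢
    exact lk_exch_gor ((BX.J (hx 1)).J hV) (hx 2) hU one_pos (lk_swap n2 V1) (lk_swap U1 V2)
      (by omega) g1
  have g3 : lkGor (lkJ (lkJ (lkJ (lkJ ⊥ (x 0)) W) U) V) (w + m + n - 3) := by
    rw [lk_J_comm (lkJ ⊥ (x 0)), lk_J_comm (lkJ (lkJ ⊥ (x 0)) U)] at g2 ⊢
    exact lk_exch_gor ((BX.J hU).J hV) (hx 1) hW one_pos
      (lk_swap a1 (by rw [lk_J_comm (lkJ ⊥ (x 0))]; exact V2))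
      (lk_swap a2 (by rw [lk_J_comm (lkJ ⊥ (x 0))]; exact V3))
      (by omega) g2
  have g4 : lkGor (lkJ (lkJ (lkJ (lkJ ⊥ F) W) U) V) (a + w + m + n - 4) := by
    rw [lk_J_comm ⊥, lk_J_comm (lkJ ⊥ W), lk_J_comm (lkJ (lkJ ⊥ W) U)] at g3 ⊢
    exact lk_exch_gor ((BW.J hU).J hV) (hx 0) hF one_pos
      (lk_swap a3 (by rw [lk_J_comm (lkJ ⊥ W), lk_J_comm ⊥]; exact V3))
      (lk_swap a4 (by rw [lk_J_comm (lkJ ⊥ W), lk_J_comm ⊥]; exact V4))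
      (by omega) g3
  have g5 : lkGor (lkJ (lkJ (lkJ (lkJ ⊥ F) G) U) V) (a + b + m + n - 4) := by
    rw [lk_J_comm (lkJ ⊥ F), lk_J_comm (lkJ (lkJ ⊥ F) U)] at g4 ⊢
    exact lk_exch_gor ((BF.J hU).J hV) hW hG hw
      (lk_swap a5 (by rw [lk_J_comm (lkJ ⊥ F)]; exact V4))
      (lk_swap a6 (by rw [lk_J_comm (lkJ ⊥ F)]; exact V5))
      (by omega) g4
  exact ⟨U, V, m, n, _, hU, hV, hDm, hDn, by omega, U4, V5, g5⟩


theorem lk_finrank_map {K V W : Type*} [Field K] [AddCommGroup V] [Module K V] [AddCommGroup W]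
    [Module K W] [Module.Finite K V] (f : V →ₗ[K] W) (p : Submodule K V)
    (h : LinearMap.ker f ≤ p) :
    Module.finrank K (p.map f) + Module.finrank K (LinearMap.ker f) = Module.finrank K p := by
  have h1 := (f.domRestrict p).finrank_range_add_finrank_ker
  rw [LinearMap.range_domRestrict, LinearMap.ker_domRestrict] at h1
  rw [← h1, ← (Submodule.comapSubtypeEquivOfLe h).finrank_eq]

theorem lk_l_comp {K : Type*} [Field K] {l : MvPolynomial (Fin 4) K →ₗ[K] K} {s : ℕ}
    (hl : ∀ n, n ≠ s → ∀ x : MvPolynomial (Fin 4) K, x.IsHomogeneous n → l x = 0)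
    {x : MvPolynomial (Fin 4) K} {t j : ℕ} (hx : x.IsHomogeneous t) (htj : t + j = s)
    (w : MvPolynomial (Fin 4) K) :
    l (x * w) = l (x * MvPolynomial.homogeneousComponent j w) := by
  induction w using MvPolynomial.induction_on' with
  | monomial d r =>
    have h1 : (MvPolynomial.monomial d r : MvPolynomial (Fin 4) K).IsHomogeneous d.degree :=
      MvPolynomial.isHomogeneous_monomial r rfl
    rw [MvPolynomial.homogeneousComponent_of_mem h1]
    split_ifs with h
    · rfl
    · rw [mul_zero, map_zero]
      exact hl _ (by omega) _ (hx.mul h1)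
  | add p q hp hq => simp [mul_add, hp, hq]

/-- The perfect pairing on the Artinian Gorenstein quotient computes colon ideals. -/
theorem lk_pairing {K : Type*} [Field K] {Q A C : Ideal (MvPolynomial (Fin 4) K)} {s t j : ℕ}
    (hQ : lkGor Q s) (hA : lkHom A) (hQA : Q ≤ A) (hC : ∀ x, x ∈ C ↔ ∀ y ∈ A, x * y ∈ Q)
    (htj : t + j = s) :
    Module.finrank K (lkD C t) = Module.finrank K (lkD Q t) + hilbFn A j := by
  obtain ⟨l, hl, hlQ⟩ := hQ
  let R := MvPolynomial (Fin 4) K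
  let Rd := fun n => MvPolynomial.homogeneousSubmodule (Fin 4) K n
  let β : Rd t →ₗ[K] Rd j →ₗ[K] K :=
    ((LinearMap.mul K R).compr₂ l).compl₁₂ (Rd t).subtype (Rd j).subtype
  have hβ : ∀ x y, β x y = l ((x : R) * (y : R)) := fun x y => rfl
  have hmemQ : ∀ {t j : ℕ}, t + j = s → ∀ x : Rd t, (x : R) ∈ Q ↔ ∀ y : Rd j, l ((x : R) * (y : R)) = 0 := by
    intro t j htj x
    rw [hlQ]
    constructor
    · intro h y; exact h y
    · intro h z
      rw [lk_l_comp hl x.2 htj]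
      exact h ⟨_, MvPolynomial.homogeneousComponent_isHomogeneous j z⟩
  have hker : LinearMap.ker β = lkD Q t := by
    ext x
    rw [LinearMap.mem_ker, lk_mem_D, hmemQ htj]
    exact ⟨fun h y => by rw [← hβ, h]; rfl, fun h => LinearMap.ext fun y => h y⟩
  have hkerf : LinearMap.ker β.flip = lkD Q j := by
    ext x
    rw [LinearMap.mem_ker, lk_mem_D, hmemQ (by omega : j + t = s)]
    constructor
    · intro h y
      rw [mul_comm, ← hβ]
      exact LinearMap.congr_fun h y
    · intro h
      ext y
      have := h y
      rw [mul_comm] at this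
      exact this
  have hCt : lkD C t = (lkD A j).dualAnnihilator.comap β := by
    ext x
    rw [lk_mem_D, hC, Submodule.mem_comap, Submodule.mem_dualAnnihilator]
    constructor
    · intro h w hw
      rw [hβ]
      simpa using (hlQ _).1 (h w hw) 1
    · intro h y hy
      rw [hlQ]
      intro z
      rw [mul_assoc, lk_l_comp hl x.2 htj]
      exact h ⟨_, MvPolynomial.homogeneousComponent_isHomogeneous j (y * z)⟩
        (MvPolynomial.homogeneousComponent_mem_of_mem hA (A.mul_mem_right z hy) j)
  have hrange : (lkD A j).dualAnnihilator ≤ LinearMap.range β := by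
    have h1 : (LinearMap.ker β.flip).dualAnnihilator = LinearMap.range β := by
      have := LinearMap.dualAnnihilator_ker_eq_range_flip (B := β.flip)
      exact this
    rw [← h1, hkerf]
    exact Submodule.dualAnnihilator_anti (fun x hx => hQA hx)
  have hQC : lkD Q t ≤ lkD C t := fun x hx => (hC _).2 fun y _ => Q.mul_mem_right y hx
  have h1 := lk_finrank_map β (lkD C t) (hker ▸ hQC)
  have h2 : (lkD C t).map β = (lkD A j).dualAnnihilator := by
    rw [hCt, Submodule.map_comap_eq, inf_eq_right]
    exact hrange
  have h4 := Subspace.finrank_add_finrank_dualAnnihilator_eq (lkD A j)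
  have h5 := lk_hilb_add A j
  rw [h2, hker] at h1
  have h1b : Module.finrank K (lkD A j).dualAnnihilator + Module.finrank K (lkD Q t) =
    Module.finrank K (lkD C t) := h1
  have h4b : Module.finrank K (lkD A j) + Module.finrank K (lkD A j).dualAnnihilator =
    Module.finrank K (MvPolynomial.homogeneousSubmodule (Fin 4) K j) := h4
  clear h1 h4
  omega

/-- Hilbert function of `A + (U, V)` in the absence of low-degree syzygies. -/
theorem lk_hilb_JJ {K : Type*} [Field K] {A : Ideal (MvPolynomial (Fin 4) K)} (hA : lkHom A)
    {U V : MvPolynomial (Fin 4) K} {m n i k j : ℕ} (hU : U.IsHomogeneous m)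
    (hV : V.IsHomogeneous n) (hi : m + i = j) (hk : n + k = j)
    (H : ∀ x y : MvPolynomial (Fin 4) K, x.IsHomogeneous i → y.IsHomogeneous k →
      U * x + V * y ∈ A → x ∈ A ∧ y ∈ A) :
    hilbFn (lkJ (lkJ A U) V) j + hilbFn A i + hilbFn A k = hilbFn A j := by
  let φ := (lkMulQ A hU i j hi).coprod (lkMulQ A hV k j hk)
  have hinj : Function.Injective φ := by
    rw [← LinearMap.ker_eq_bot, LinearMap.ker_eq_bot']
    rintro ⟨x, y⟩ hx
    obtain ⟨x, rfl⟩ := Submodule.mkQ_surjective _ x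
    obtain ⟨y, rfl⟩ := Submodule.mkQ_surjective _ y
    simp only [φ, LinearMap.coprod_apply, lkMulQ, Submodule.mkQ_apply, Submodule.mapQ_apply,
      ← Submodule.Quotient.mk_add, Submodule.Quotient.mk_eq_zero] at hx
    obtain ⟨h1, h2⟩ := H x y x.2 y.2 hx
    simp only [Prod.mk_eq_zero, Submodule.mkQ_apply, Submodule.Quotient.mk_eq_zero]
    exact ⟨h1, h2⟩
  have hle : lkD A j ≤ lkD (lkJ (lkJ A U) V) j := fun x hx => lk_le_J _ _ (lk_le_J _ _ hx)
  have hr : LinearMap.range φ = (lkD (lkJ (lkJ A U) V) j).map (lkD A j).mkQ := by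
    ext z
    constructor
    · rintro ⟨⟨x, y⟩, rfl⟩
      obtain ⟨x, rfl⟩ := Submodule.mkQ_surjective _ x
      obtain ⟨y, rfl⟩ := Submodule.mkQ_surjective _ y
      refine ⟨lkMul hU i j hi x + lkMul hV k j hk y, ?_, ?_⟩
      · refine lk_mem_J.2 ⟨U * x, ?_, y, rfl⟩
        exact lk_mem_J.2 ⟨0, A.zero_mem, x, by simp⟩
      · simp [φ, lkMulQ]
    · rintro ⟨z, hz, rfl⟩
      obtain ⟨b, hb, y, hy⟩ := lk_mem_J.1 hz
      obtain ⟨b', hb', x, rfl⟩ := lk_mem_J.1 hb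
      refine ⟨(Submodule.mkQ _ ⟨MvPolynomial.homogeneousComponent i x,
        MvPolynomial.homogeneousComponent_isHomogeneous i x⟩, Submodule.mkQ _
        ⟨MvPolynomial.homogeneousComponent k y,
        MvPolynomial.homogeneousComponent_isHomogeneous k y⟩), ?_⟩
      simp only [φ, LinearMap.coprod_apply, lkMulQ, Submodule.mkQ_apply, Submodule.mapQ_apply,
        ← Submodule.Quotient.mk_add]
      rw [Submodule.Quotient.eq, lk_mem_D]
      have h1 := MvPolynomial.homogeneousComponent_mem_of_mem hA hb' j
      have h2 := congrArg (MvPolynomial.homogeneousComponent j) hy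
      have h3 := lk_comp_mul hU i x
      have h4 := lk_comp_mul hV k y
      rw [hi] at h3
      rw [hk] at h4
      have hz2 := MvPolynomial.homogeneousComponent_eq_self z.2
      simp only [Submodule.subtype_apply] at h2
      rw [hz2, map_add, map_add, h3, h4] at h2
      have h5 := A.neg_mem h1
      convert h5 using 1
      rw [Submodule.coe_sub, Submodule.coe_add, lk_mul_coe, lk_mul_coe, h2]
      ring
  have h1 := LinearMap.finrank_range_of_inj hinj
  rw [hr, Module.finrank_prod] at h1
  have h2 : Module.finrank K ((lkD (lkJ (lkJ A U) V) j).map (lkD A j).mkQ) +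
      Module.finrank K (lkD A j) = Module.finrank K (lkD (lkJ (lkJ A U) V) j) := by
    have h := lk_finrank_map (lkD A j).mkQ (lkD (lkJ (lkJ A U) V) j)
      (by rw [Submodule.ker_mkQ]; exact hle)
    rw [Submodule.ker_mkQ] at h
    exact h
  have h3 := lk_hilb_add A j
  have h4 := lk_hilb_add (lkJ (lkJ A U) V) j
  have h5 : Module.finrank K (MvPolynomial.homogeneousSubmodule (Fin 4) K i ⧸ lkD A i) =
    hilbFn A i := rfl
  have h6 : Module.finrank K (MvPolynomial.homogeneousSubmodule (Fin 4) K k ⧸ lkD A k) =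
    hilbFn A k := rfl
  omega

/-- A homogeneous ideal is generated in bounded degree. -/
theorem lk_bdd {K : Type*} [Field K] {A : Ideal (MvPolynomial (Fin 4) K)} (hA : lkHom A) :
    ∃ D : ℕ, ∀ (J : Ideal (MvPolynomial (Fin 4) K)) (x : MvPolynomial (Fin 4) K),
      (∀ n ≤ D, ∀ g ∈ A, g.IsHomogeneous n → x * g ∈ J) → ∀ g ∈ A, x * g ∈ J := by
  obtain ⟨S, hS⟩ := (isNoetherianRing_iff_ideal_fg _).1
    (inferInstance : IsNoetherianRing (MvPolynomial (Fin 4) K)) A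
  refine ⟨S.sup MvPolynomial.totalDegree, fun J x H => ?_⟩
  have : A ≤ Submodule.colon J {x} := by
    rw [← hS]
    refine Ideal.span_le.2 fun g hg => ?_
    have hgA : g ∈ A := hS ▸ Ideal.subset_span hg
    simp only [SetLike.mem_coe, Submodule.mem_colon_singleton, smul_eq_mul]
    rw [← MvPolynomial.sum_homogeneousComponent g, Finset.sum_mul]
    refine J.sum_mem fun n hn => ?_
    rw [mul_comm]
    refine H n ?_ _ (MvPolynomial.homogeneousComponent_mem_of_mem hA hgA n)
      (MvPolynomial.homogeneousComponent_isHomogeneous n g)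
    have h1 : g.totalDegree ≤ S.sup MvPolynomial.totalDegree := Finset.le_sup hg
    have := Finset.mem_range.1 hn
    omega
  intro g hg
  have := this hg
  simp only [Submodule.mem_colon_singleton, smul_eq_mul] at this
  rwa [mul_comm]

/-- One half of the liaison formula. -/
theorem lk_half {K : Type*} [Field K] {F G : MvPolynomial (Fin 4) K} {a b : ℕ}
    (hF : F.IsHomogeneous a) (hG : G.IsHomogeneous b) (ha : 0 < a) (hb : 0 < b)
    (hNF : lkNZ ⊥ F) (hNG : lkNZ (lkJ ⊥ F) G)
    {I₁ I₂ : Ideal (MvPolynomial (Fin 4) K)} (h1 : lkHom I₁) (h2 : lkHom I₂)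
    (h12 : ∀ x, x ∈ I₂ ↔ ∀ y ∈ I₁, x * y ∈ lkJ (lkJ ⊥ F) G)
    (h21 : ∀ x, x ∈ I₁ ↔ ∀ y ∈ I₂, x * y ∈ lkJ (lkJ ⊥ F) G)
    {d g : ℤ} (hilb : ∃ N : ℕ, ∀ t ≥ N, (hilbFn I₁ t : ℤ) = d * t + 1 - g) :
    ∃ T : ℕ, ∀ t ≥ T, (hilbFn (lkJ (lkJ ⊥ F) G) t : ℤ) - hilbFn I₂ t =
      d * (t - ((a : ℤ) + b - 4)) - (1 - g) := by
  obtain ⟨D₁, hD₁⟩ := lk_bdd h1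
  obtain ⟨D₂, hD₂⟩ := lk_bdd h2
  obtain ⟨N, hN⟩ := hilb
  refine ⟨a + b + D₂ + 1, fun t ht => ?_⟩
  obtain ⟨U, V, m, n, s, hU, hV, hm, hn, hs, hNU, hNV, hgor⟩ :=
    lk_params hF hG ha hb hNF hNG (2 * t + D₁ + N + 10)
  have hQ0 : lkHom (lkJ (lkJ ⊥ F) G) := (lkHom.bot.J hF).J hG
  revert hNU hNV hgor h12 h21 hQ0
  generalize lkJ (lkJ ⊥ F) G = Q0
  intro h12 h21 hNU hNV hgor hQ0
  have hQI : Q0 ≤ I₁ := fun x hx => (h21 x).2 fun y _ => Q0.mul_mem_right y hx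
  have hle : Q0 ≤ lkJ (lkJ Q0 U) V := fun x hx => lk_le_J _ _ (lk_le_J _ _ hx)
  have hlow : ∀ e : ℕ, e < m → e < n → ∀ x : MvPolynomial (Fin 4) K, x.IsHomogeneous e →
      x ∈ lkJ (lkJ Q0 U) V → x ∈ Q0 := fun e he1 he2 x hx hxJ =>
    lk_low hQ0 hU hx he1 (lk_low (hQ0.J hU) hV hx he2 hxJ)
  have hAU : U ∈ lkJ (lkJ Q0 U) V := lk_le_J _ _ (lk_self_mem_J _ _)
  have hAV : V ∈ lkJ (lkJ Q0 U) V := lk_self_mem_J _ _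
  have hQA : lkJ (lkJ Q0 U) V ≤ lkJ (lkJ I₁ U) V :=
    sup_le_sup_right (sup_le_sup_right hQI _) _
  have hpair := lk_pairing (t := t) (j := s - t)
    (C := Submodule.colon (lkJ (lkJ Q0 U) V) (lkJ (lkJ I₁ U) V)) hgor ((h1.J hU).J hV) hQA
    (fun x => by rw [Submodule.mem_colon]; rfl) (by omega)
  have hCt : lkD (Submodule.colon (lkJ (lkJ Q0 U) V) (lkJ (lkJ I₁ U) V)) t = lkD I₂ t := by
    ext x
    rw [lk_mem_D, lk_mem_D, Submodule.mem_colon]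
    constructor
    · intro H
      rw [h12]
      refine hD₁ Q0 x fun e he y hy hye => ?_
      refine hlow (t + e) (by omega) (by omega) _ (x.2.mul hye) ?_
      exact H y (lk_le_J _ _ (lk_le_J _ _ hy))
    · intro hx y hy
      obtain ⟨z, hz, v, rfl⟩ := lk_mem_J.1 hy
      obtain ⟨w, hw, u, rfl⟩ := lk_mem_J.1 hz
      rw [smul_eq_mul, mul_add, mul_add]
      refine add_mem (add_mem (hle ((h12 _).1 hx w hw)) ?_) ?_
      · exact Ideal.mul_mem_left _ _ (Ideal.mul_mem_right _ _ hAU)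
      · exact Ideal.mul_mem_left _ _ (Ideal.mul_mem_right _ _ hAV)
  have hQt : lkD (lkJ (lkJ Q0 U) V) t = lkD Q0 t := by
    ext x
    exact ⟨fun hx => hlow t (by omega) (by omega) _ x.2 hx, fun hx => hle hx⟩
  have hJJ := lk_hilb_JJ h1 hU hV (i := s - t - m) (k := s - t - n) (j := s - t)
    (by omega) (by omega) (by
      intro x y hx hy hxy
      have key : ∀ e ≤ D₂, ∀ g ∈ I₂, g.IsHomogeneous e → x * g ∈ Q0 ∧ y * g ∈ Q0 := by
        intro e he g hg hge
        have k1 := (h21 _).1 hxy g hg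
        have k2 : V * (y * g) ∈ lkJ Q0 U :=
          lk_mem_J.2 ⟨_, k1, - (x * g), by ring⟩
        have k3 : y * g ∈ Q0 :=
          lk_low hQ0 hU (hy.mul hge) (by omega) (hNV _ k2)
        refine ⟨hNU _ ?_, k3⟩
        have k4 : U * (x * g) = (U * x + V * y) * g - V * (y * g) := by ring
        rw [k4]
        exact Q0.sub_mem k1 (Q0.mul_mem_left _ k3)
      exact ⟨(h21 _).2 (hD₂ Q0 x fun e he g hg hge => (key e he g hg hge).1),
        (h21 _).2 (hD₂ Q0 y fun e he g hg hge => (key e he g hg hge).2)⟩)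
  rw [hCt, hQt] at hpair
  have e1 := lk_hilb_add I₂ t
  have e2 := lk_hilb_add Q0 t
  have e3 : (hilbFn Q0 t : ℤ) - hilbFn I₂ t = hilbFn (lkJ (lkJ I₁ U) V) (s - t) := by omega
  have f1 := hN (s - t) (by omega)
  have f2 := hN (s - t - m) (by omega)
  have f3 := hN (s - t - n) (by omega)
  have g1 : ((s - t : ℕ) : ℤ) = (a : ℤ) + b + m + n - 4 - t := by omega
  have g2 : ((s - t - m : ℕ) : ℤ) = (a : ℤ) + b + n - 4 - t := by omega
  have g3 : ((s - t - n : ℕ) : ℤ) = (a : ℤ) + b + m - 4 - t := by omega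
  rw [g1] at f1
  rw [g2] at f2
  rw [g3] at f3
  have hJJz : (hilbFn (lkJ (lkJ I₁ U) V) (s - t) : ℤ) + hilbFn I₁ (s - t - m) +
    hilbFn I₁ (s - t - n) = hilbFn I₁ (s - t) := by exact_mod_cast hJJ
  rw [e3]
  linear_combination hJJz + f1 - f2 - f3

theorem lk_height_prime {A : Type*} [CommRing A] (p : PrimeSpectrum A) :
    idealHeight p.asIdeal = (Order.height p : WithBot ℕ∞) := by
  rw [Order.height_eq_krullDim_Iic]
  unfold idealHeight
  apply le_antisymm
  · exact iInf_le (fun q : {q : PrimeSpectrum A // p.asIdeal ≤ q.asIdeal} =>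
      Order.krullDim {r : PrimeSpectrum A // r ≤ q.1}) ⟨p, le_rfl⟩
  · refine le_iInf fun q => ?_
    exact Order.krullDim_le_of_strictMono
      (fun r : Set.Iic p => (⟨r.1, r.2.trans q.2⟩ : {r : PrimeSpectrum A // r ≤ q.1}))
      (fun r s h => h)

theorem lk_prime_eq {A : Type*} [CommRing A] {P P' : Ideal A} (hP : P.IsPrime) (hP' : P'.IsPrime)
    (hle : P' ≤ P) (h1 : idealHeight P = (2 : ℕ)) (h2 : idealHeight P' = (2 : ℕ)) : P' = P := by
  have e1 := lk_height_prime ⟨P, hP⟩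
  have e2 := lk_height_prime ⟨P', hP'⟩
  by_contra hne
  have hlt : (⟨P', hP'⟩ : PrimeSpectrum A) < ⟨P, hP⟩ := lt_of_le_of_ne hle (by simpa using hne)
  rw [h1] at e1
  rw [h2] at e2
  have f1 : Order.height (⟨P, hP⟩ : PrimeSpectrum A) = (2 : ℕ) := WithBot.coe_injective e1.symm
  have f2 : Order.height (⟨P', hP'⟩ : PrimeSpectrum A) = (2 : ℕ) := WithBot.coe_injective e2.symm
  have := Order.height_strictMono hlt (by rw [f2]; exact ENat.natCast_lt_top 2)
  rw [f1, f2] at this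
  exact lt_irrefl _ this

/-- The linked ideals are each other's residuals. -/
theorem lk_residual {A : Type*} [CommRing A] [IsNoetherianRing A] {I₁ I₂ : Ideal A}
    (h1 : ∀ P ∈ associatedPrimes A (A ⧸ I₁), idealHeight P = (2 : ℕ))
    (h2 : ∀ P ∈ associatedPrimes A (A ⧸ I₂), idealHeight P = (2 : ℕ))
    (hdisj : associatedPrimes A (A ⧸ I₁) ∩ associatedPrimes A (A ⧸ I₂) = ∅) (x : A) :
    x ∈ I₁ ↔ ∀ y ∈ I₂, x * y ∈ I₁ ⊓ I₂ := by
  constructor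
  · intro hx y hy
    exact ⟨I₁.mul_mem_right y hx, I₂.mul_mem_left x hy⟩
  · intro H
    by_contra hx
    have hx0 : Ideal.Quotient.mk I₁ x ≠ 0 := by rwa [Ne, Ideal.Quotient.eq_zero_iff_mem]
    obtain ⟨P, hP, hle⟩ := exists_le_isAssociatedPrime_of_isNoetherianRing A _ hx0
    have hI₂P : I₂ ≤ P := by
      refine le_trans (fun y hy => ?_) hle
      rw [Submodule.mem_colon_singleton, Submodule.mem_bot]
      change Ideal.Quotient.mk I₁ (y * x) = 0
      rw [Ideal.Quotient.eq_zero_iff_mem, mul_comm]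
      exact (H y hy).1
    have hPp := hP.isPrime
    obtain ⟨P', hP', hP'le⟩ := Ideal.exists_minimalPrimes_le hI₂P
    have hass : P' ∈ associatedPrimes A (A ⧸ I₂) := by
      apply Module.associatedPrimes.minimalPrimes_annihilator_subset_associatedPrimes
      rwa [Ideal.annihilator_quotient]
    have := lk_prime_eq hPp hP'.1.1 hP'le (h1 P hP) (h2 P' hass)
    subst this
    have : P' ∈ (∅ : Set (Ideal A)) := hdisj ▸ ⟨hP, hass⟩
    exact this

theorem lk_span_pair {A : Type*} [CommRing A] (F G : A) :
    lkJ (lkJ ⊥ F) G = Ideal.span {F, G} := by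
  unfold lkJ
  rw [bot_sup_eq, Ideal.span_insert]

open Pointwise in
theorem lk_reg {A : Type*} [CommRing A] {F G : A}
    (hreg : RingTheory.Sequence.IsRegular A [F, G]) : lkNZ ⊥ F ∧ lkNZ (lkJ ⊥ F) G := by
  rw [RingTheory.Sequence.isRegular_cons_iff, RingTheory.Sequence.isRegular_cons_iff] at hreg
  obtain ⟨h1, h2, -⟩ := hreg
  constructor
  · intro x hx
    rw [Ideal.mem_bot] at hx ⊢
    exact (isSMulRegular_iff_right_eq_zero_of_smul).1 h1 x hx
  · have h3 := (isSMulRegular_quotient_iff_mem_of_smul_mem _ _).1 h2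
    have key : ∀ x, x ∈ (F • (⊤ : Submodule A A)) ↔ x ∈ lkJ ⊥ F := by
      intro x
      rw [lk_mem_J, Submodule.mem_smul_pointwise_iff_exists]
      constructor
      · rintro ⟨c, -, rfl⟩
        exact ⟨0, zero_mem _, c, by simp⟩
      · rintro ⟨z, hz, c, rfl⟩
        rw [Ideal.mem_bot] at hz
        exact ⟨c, trivial, by simp [hz]⟩
    intro x hx
    rw [← key] at hx ⊢
    exact h3 x hx

theorem lk_deg_pos {K : Type*} [Field K] {B J : Ideal (MvPolynomial (Fin 4) K)}
    {F : MvPolynomial (Fin 4) K} {a : ℕ} (hF : F.IsHomogeneous a) (hN : lkNZ B F)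
    (hBJ : B ≤ J) (hFJ : F ∈ J) (hJ : J ≠ ⊤) : 0 < a := by
  rw [Nat.pos_iff_ne_zero]
  rintro rfl
  have h0 : F.totalDegree = 0 := Nat.le_zero.1 hF.totalDegree_le
  rw [MvPolynomial.totalDegree_eq_zero_iff_eq_C] at h0
  apply hJ
  rw [Ideal.eq_top_iff_one]
  by_cases hc : MvPolynomial.coeff 0 F = 0
  · rw [hc, map_zero] at h0
    exact hBJ (hN 1 (by rw [h0, zero_mul]; exact B.zero_mem))
  · have : (1 : MvPolynomial (Fin 4) K) = MvPolynomial.C (MvPolynomial.coeff 0 F)⁻¹ * F := by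
      conv_rhs => rw [h0]
      rw [← map_mul]
      simp [inv_mul_cancel₀ hc]
    rw [this]
    exact J.mul_mem_left _ hFJ

/-- If two curves `C₁, C₂ ⊆ P³` of degrees `d₁, d₂` and arithmetic genera `g₁, g₂`
(so the Hilbert polynomial of `R/I_{Cᵢ}` is `dᵢ·t + 1 − gᵢ`) are geometrically linked
by the complete intersection of two surfaces of degrees `a` and `b`, then
`g₁ − g₂ = ½ (a + b − 4)(d₁ − d₂)`. -/
theorem stmt_15 {K : Type*} [Field K] (a b d₁ d₂ : ℕ) (g₁ g₂ : ℤ)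
    (I₁ I₂ : Ideal (MvPolynomial (Fin 4) K))
    (h1hom : I₁.IsHomogeneous (MvPolynomial.homogeneousSubmodule (Fin 4) K))
    (h2hom : I₂.IsHomogeneous (MvPolynomial.homogeneousSubmodule (Fin 4) K))
    (h1top : I₁ ≠ ⊤) (h2top : I₂ ≠ ⊤)
    -- `C₁` and `C₂` are curves: equidimensional of codimension two in `P³`
    (h1curve : ∀ P ∈ associatedPrimes (MvPolynomial (Fin 4) K)
      (MvPolynomial (Fin 4) K ⧸ I₁), idealHeight P = (2 : ℕ))
    (h2curve : ∀ P ∈ associatedPrimes (MvPolynomial (Fin 4) K)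
      (MvPolynomial (Fin 4) K ⧸ I₂), idealHeight P = (2 : ℕ))
    -- the complete intersection `X` of surfaces of degrees `a` and `b`
    (F G : MvPolynomial (Fin 4) K)
    (hF : F.IsHomogeneous a) (hG : G.IsHomogeneous b)
    (hreg : RingTheory.Sequence.IsRegular (MvPolynomial (Fin 4) K) [F, G])
    -- geometric linkage: `I_{C₁} ∩ I_{C₂} = I_X` and no common component
    (hlink : I₁ ⊓ I₂ = Ideal.span {F, G})
    (hdisj : associatedPrimes (MvPolynomial (Fin 4) K) (MvPolynomial (Fin 4) K ⧸ I₁) ∩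
        associatedPrimes (MvPolynomial (Fin 4) K) (MvPolynomial (Fin 4) K ⧸ I₂) = ∅)
    -- Hilbert polynomials: `P_{R/I_{Cᵢ}}(t) = dᵢ t + 1 − gᵢ`
    (hilb1 : ∃ N : ℕ, ∀ t ≥ N, (hilbFn I₁ t : ℤ) = d₁ * t + 1 - g₁)
    (hilb2 : ∃ N : ℕ, ∀ t ≥ N, (hilbFn I₂ t : ℤ) = d₂ * t + 1 - g₂) :
    2 * (g₁ - g₂) = ((a : ℤ) + b - 4) * ((d₁ : ℤ) - d₂) := by
  obtain ⟨hNF, hNG⟩ := lk_reg hreg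
  have hsp := lk_span_pair F G
  have hJtop : lkJ (lkJ ⊥ F) G ≠ ⊤ := by
    rw [hsp, ← hlink]
    intro h
    exact h1top (top_le_iff.1 (h ▸ inf_le_left))
  have ha : 0 < a := lk_deg_pos hF hNF bot_le (lk_le_J _ _ (lk_self_mem_J _ _)) hJtop
  have hb : 0 < b := lk_deg_pos hG hNG (lk_le_J _ _) (lk_self_mem_J _ _) hJtop
  have h21 : ∀ x, x ∈ I₁ ↔ ∀ y ∈ I₂, x * y ∈ lkJ (lkJ ⊥ F) G := by
    rw [hsp, ← hlink]
    exact lk_residual h1curve h2curve hdisj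
  have h12 : ∀ x, x ∈ I₂ ↔ ∀ y ∈ I₁, x * y ∈ lkJ (lkJ ⊥ F) G := by
    rw [hsp, ← hlink, inf_comm]
    exact lk_residual h2curve h1curve (by rw [Set.inter_comm]; exact hdisj)
  obtain ⟨T₁, hT₁⟩ := lk_half hF hG ha hb hNF hNG h1hom h2hom h12 h21 hilb1
  obtain ⟨T₂, hT₂⟩ := lk_half hF hG ha hb hNF hNG h2hom h1hom h21 h12 hilb2
  obtain ⟨N₁, hN₁⟩ := hilb1
  obtain ⟨N₂, hN₂⟩ := hilb2
  have e1 := hT₁ (T₁ + T₂ + N₁ + N₂) (by omega)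
  have e2 := hT₂ (T₁ + T₂ + N₁ + N₂) (by omega)
  have e3 := hN₁ (T₁ + T₂ + N₁ + N₂) (by omega)
  have e4 := hN₂ (T₁ + T₂ + N₁ + N₂) (by omega)
  linear_combination e2 - e1 + e3 - e4
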